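/- Let $\Omega$ be a finite set with $|\Omega| \ge 4$, let $A : \Omega \to \mathbb{R}$ satisfy $0 \le A(\omega) \le 1$ for all $\omega$, and let $\mu = \frac{1}{|\Omega|}\sum_{\omega} A(\omega)$ and $\sigma = \sqrt{\frac{1}{|\Omega|}\sum_{\omega} (A(\omega) - \mu)^2}$. Suppose $\omega_+ \ne \omega_-$ are two extreme elements of $\Omega$, that is, $A(\omega_-) \le A(\omega) \le A(\omega_+)$ for all $\omega \in \Omega$, with $A(\omega_+) - \mu \ge \sigma$ and $\mu - A(\omega_-) \ge \sigma$, and set $R = A(\omega_+) - A(\omega_-)$. Fix an integer $1 \le L \le |\Omega| - 2$, $\varepsilon > 0$ and $\delta \in (0,1)$, and define, for an injective $s : \{1,\dots,L\} \to \Omega \setminus \{\omega_+, \omega_-\}$, the estimator $$\tilde{A} = \frac{1}{L+2}\Bigl( A(\omega_-) + A(\omega_+) + \sum_{l=1}^{L} A(s(l)) \Bigr).$$ If $$L \cdot \frac{|\Omega| - 2 - L}{|\Omega| - 3} \ \ge\ \frac{\ln\bigl(2(|\Omega| - 2)/\delta\bigr)\, R^2}{2\varepsilon^2},$$ then under the uniform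 distribution on injective functions $s : \{1,\dots,L\} \to \Omega \setminus \{\omega_+, \omega_-\}$, the probability that $|\tilde{A} - \mu| \le \varepsilon$ is at least $1 - \delta$. -/

import Mathlib

/-- The population mean of `A` over the finite type `Ω`. -/
noncomputable def populationMean {Ω : Type*} [Fintype Ω] (A : Ω → ℝ) : ℝ :=
  (1 / (Fintype.card Ω : ℝ)) * ∑ ω, A ω

/-- The population standard deviation of `A` over the finite type `Ω`. -/
noncomputable def populationStd {Ω : Type*} [Fintype Ω] (A : Ω → ℝ) : ℝ :=
  Real.sqrt ((1 / (Fintype.card Ω : ℝ)) * ∑ ω, (A ω - populationMean A) ^ 2)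

/-- The probability of the event `P` under the uniform distribution on a (nonempty) finite
type `α`. -/
noncomputable def uniformProb {α : Type*} [Finite α] (P : α → Prop) : ℝ :=
  (Nat.card {x : α // P x} : ℝ) / (Nat.card α : ℝ)

/-- The mean accuracy of the two known sequences `ωp`, `ωm` together with the `L` sequences
`s 0, …, s (L - 1)` drawn from the other elements of `Ω`. -/
noncomputable def augmentedEstimator {Ω : Type*} (A : Ω → ℝ) (ωp ωm : Ω) {L : ℕ}
    (s : Fin L ↪ {ω : Ω // ω ≠ ωp ∧ ω ≠ ωm}) : ℝ :=
  (A ωm + A ωp + ∑ l, A (s l).1) / ((L : ℝ) + 2)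

open ProbabilityTheory MeasureTheory in
/-- Hoeffding's lemma for the uniform distribution on a finite type. -/
lemma sum_exp_mul_sub_populationMean_le {α : Type*} [Fintype α] [Nonempty α] (x : α → ℝ)
    {a b : ℝ} (hx : ∀ i, x i ∈ Set.Icc a b) (t : ℝ) :
    ∑ i, Real.exp (t * (x i - populationMean x))
      ≤ Fintype.card α * Real.exp (t ^ 2 * (b - a) ^ 2 / 8) := by
  let _ : MeasurableSpace α := ⊤
  have _ : DiscreteMeasurableSpace α := ⟨fun _ => trivial⟩
  set P : Measure α := (PMF.uniformOfFintype α).toMeasure with hP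
  have hint : ∀ f : α → ℝ, ∫ i, f i ∂P = (1 / (Fintype.card α : ℝ)) * ∑ i, f i := by
    intro f
    rw [hP, PMF.integral_eq_sum, Finset.mul_sum]
    simp
  have hsub := (hasSubgaussianMGF_of_mem_Icc (μ := P) (X := x) (a := a) (b := b)
    (measurable_of_finite x).aemeasurable (Filter.Eventually.of_forall hx)).mgf_le t
  have hmean : ∫ i, x i ∂P = populationMean x := hint x
  rw [mgf, hint, hmean] at hsub
  have hc : (0 : ℝ) < Fintype.card α := by exact_mod_cast Fintype.card_pos
  rw [one_div, inv_mul_le_iff₀ hc] at hsub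
  refine hsub.trans (le_of_eq ?_)
  congr 2
  simp only [NNReal.coe_pow, NNReal.coe_div, coe_nnnorm, Real.norm_eq_abs, NNReal.coe_ofNat,
    div_pow, sq_abs]
  ring

/-- An injective sequence of length `n + 1` is its first term followed by an injective sequence of
length `n` avoiding that term. -/
def embeddingFinSuccEquivSigma (n : ℕ) (α : Type*) :
    (Fin (n + 1) ↪ α) ≃ Σ a : α, (Fin n ↪ {b : α // b ≠ a}) where
  toFun s := ⟨s 0, fun i => ⟨s i.succ, fun h => Fin.succ_ne_zero i (s.injective h)⟩,
    fun i j h => Fin.succ_injective n (s.injective (congrArg Subtype.val h))⟩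
  invFun p := ⟨Fin.cons p.1 (fun i => (p.2 i).1), by
    rw [Fin.cons_injective_iff]
    refine ⟨?_, fun i j h => p.2.injective (Subtype.ext h)⟩
    rintro ⟨i, hi⟩
    exact (p.2 i).2 hi⟩
  left_inv s := by
    ext i
    refine Fin.cases ?_ (fun j => ?_) i <;> rfl
  right_inv p := rfl

/-- The mean of the population after one element has been removed. -/
lemma populationMean_subtype_ne {α : Type*} [Fintype α] [DecidableEq α] (x : α → ℝ) (a : α) :
    populationMean (fun b : {b : α // b ≠ a} => x b)
      = (Fintype.card α * populationMean x - x a) / ((Fintype.card α : ℝ) - 1) := by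
  have : Nonempty α := ⟨a⟩
  have hc : (0 : ℝ) < Fintype.card α := by exact_mod_cast Fintype.card_pos
  have hcard : (Fintype.card {b : α // b ≠ a} : ℝ) = (Fintype.card α : ℝ) - 1 := by
    rw [Fintype.card_subtype_compl, Fintype.card_subtype_eq, Nat.cast_sub Fintype.card_pos]
    simp
  have hsum : ∑ b : {b : α // b ≠ a}, x b = ∑ b, x b - x a := by
    rw [← Finset.sum_subtype (Finset.univ.erase a) (by simp) x,
      Finset.sum_erase_eq_sub (Finset.mem_univ a)]
  unfold populationMean
  rw [hcard, hsum]
  field_simp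

open Classical in
/-- Exponential moment bound for the sum of a sample drawn without replacement. -/
lemma sum_embedding_exp_le (L : ℕ) {α : Type*} [Fintype α] (hL : L ≤ Fintype.card α) (x : α → ℝ)
    {a b : ℝ} (hx : ∀ i, x i ∈ Set.Icc a b) (t : ℝ) :
    ∑ s : Fin L ↪ α, Real.exp (t * (∑ l, x (s l) - L * populationMean x))
      ≤ Fintype.card (Fin L ↪ α) * Real.exp (L * (t ^ 2 * (b - a) ^ 2 / 8)) := by
  induction L generalizing α with
  | zero => simp
  | succ L ih =>
    set M : ℝ := (Fintype.card α : ℝ) with hM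
    set ν := populationMean x with hν
    set k : ℝ := 1 - L / (M - 1) with hk
    set c : ℝ := t ^ 2 * (b - a) ^ 2 / 8 with hc
    have : Nonempty α := Fintype.card_pos_iff.mp (by omega)
    have hLM : (L : ℝ) + 1 ≤ M := by rw [hM]; exact_mod_cast hL
    have hL0 : (0 : ℝ) ≤ L := L.cast_nonneg
    have hk0 : 0 ≤ k := by
      rw [hk, sub_nonneg]
      exact div_le_one_of_le₀ (by linarith) (by linarith)
    have hk1 : k ≤ 1 := by
      rw [hk, sub_le_self_iff]
      exact div_nonneg hL0 (by linarith)
    have hcard : ∀ i : α, Fintype.card {j : α // j ≠ i} = Fintype.card α - 1 := fun i => by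
      rw [Fintype.card_subtype_compl, Fintype.card_subtype_eq]
    have hcardEmb : (Fintype.card (Fin (L + 1) ↪ α) : ℝ)
        = M * ((Fintype.card α - 1).descFactorial L : ℕ) := by
      rw [Fintype.card_embedding_eq, Fintype.card_fin]
      obtain ⟨m, hm⟩ : ∃ m, Fintype.card α = m + 1 := ⟨Fintype.card α - 1, by omega⟩
      rw [hM, hm, Nat.succ_descFactorial_succ]
      push_cast
      simp
    have hexp : ∀ (i : α) (s : Fin L ↪ {j : α // j ≠ i}),
        t * (x i + ∑ l, x (s l) - ((L + 1 : ℕ) : ℝ) * ν) = t * k * (x i - ν)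
          + t * (∑ l, x (s l) - L * populationMean (fun j : {j : α // j ≠ i} => x j)) := by
      intro i s
      rw [populationMean_subtype_ne, hk, ← hM, ← hν]
      rcases Nat.eq_zero_or_pos L with rfl | hpos
      · simp
      · have : M - 1 ≠ 0 := by
          have : (1 : ℝ) ≤ L := by exact_mod_cast hpos
          linarith
        push_cast
        field_simp
        ring
    calc ∑ s : Fin (L + 1) ↪ α, Real.exp (t * (∑ l, x (s l) - ((L + 1 : ℕ) : ℝ) * ν))
        = ∑ i, ∑ s : Fin L ↪ {j : α // j ≠ i},
            Real.exp (t * (x i + ∑ l, x (s l) - ((L + 1 : ℕ) : ℝ) * ν)) := by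
          rw [← Fintype.sum_sigma', ← (embeddingFinSuccEquivSigma L α).sum_comp]
          refine Finset.sum_congr rfl fun s _ => ?_
          rw [Fin.sum_univ_succ]
          rfl
      _ = ∑ i, Real.exp (t * k * (x i - ν)) * ∑ s : Fin L ↪ {j : α // j ≠ i},
            Real.exp (t * (∑ l, x (s l)
              - L * populationMean (fun j : {j : α // j ≠ i} => x j))) := by
          refine Finset.sum_congr rfl fun i _ => ?_
          rw [Finset.mul_sum]
          exact Finset.sum_congr rfl fun s _ => by rw [hexp, Real.exp_add]
      _ ≤ ∑ i, Real.exp (t * k * (x i - ν)) *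
            (((Fintype.card α - 1).descFactorial L : ℕ) * Real.exp (L * c)) := by
          refine Finset.sum_le_sum fun i _ => mul_le_mul_of_nonneg_left ?_ (Real.exp_nonneg _)
          have h := ih (α := {j : α // j ≠ i}) (by rw [hcard]; omega) (fun j => x j)
            (fun j => hx j)
          rwa [Fintype.card_embedding_eq, Fintype.card_fin, hcard] at h
      _ ≤ M * Real.exp c * (((Fintype.card α - 1).descFactorial L : ℕ) * Real.exp (L * c)) := by
          rw [← Finset.sum_mul]
          refine mul_le_mul_of_nonneg_right ?_ (by positivity)
          refine (sum_exp_mul_sub_populationMean_le x hx (t * k)).trans ?_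
          refine mul_le_mul_of_nonneg_left (Real.exp_le_exp.mpr ?_) (by positivity)
          have hk2 : k ^ 2 ≤ 1 := pow_le_one₀ hk0 hk1
          have h := mul_le_mul_of_nonneg_left hk2 (by positivity : 0 ≤ c)
          calc (t * k) ^ 2 * (b - a) ^ 2 / 8 = c * k ^ 2 := by rw [hc]; ring
            _ ≤ c := by linarith
      _ = Fintype.card (Fin (L + 1) ↪ α) * Real.exp (((L + 1 : ℕ) : ℝ) * c) := by
          have : ((L + 1 : ℕ) : ℝ) * c = c + L * c := by push_cast; ring
          rw [hcardEmb, this, Real.exp_add]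
          ring

open Classical in
/-- Hoeffding's inequality for sampling without replacement. -/
lemma card_embedding_abs_ge_le {L : ℕ} (hL0 : 0 < L) {α : Type*} [Fintype α]
    (hL : L ≤ Fintype.card α) (x : α → ℝ) {a b : ℝ} (hab : a < b)
    (hx : ∀ i, x i ∈ Set.Icc a b) {t : ℝ} (ht : 0 ≤ t) :
    ((Finset.univ.filter fun s : Fin L ↪ α =>
        t ≤ |∑ l, x (s l) - L * populationMean x|).card : ℝ)
      ≤ Fintype.card (Fin L ↪ α) * (2 * Real.exp (-(2 * t ^ 2 / (L * (b - a) ^ 2)))) := by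
  set D : (Fin L ↪ α) → ℝ := fun s => ∑ l, x (s l) - L * populationMean x with hD
  have hR : 0 < b - a := sub_pos.mpr hab
  have hLr : (0 : ℝ) < L := by exact_mod_cast hL0
  set r : ℝ := 4 * t / (L * (b - a) ^ 2) with hr
  have hr0 : 0 ≤ r := by positivity
  set E := Real.exp (-(r * t)) with hE
  have h₁ := sum_embedding_exp_le L hL x hx r
  have h₂ := sum_embedding_exp_le L hL x hx (-r)
  rw [neg_sq] at h₂
  calc ((Finset.univ.filter fun s => t ≤ |D s|).card : ℝ)
      = ∑ s, if t ≤ |D s| then (1 : ℝ) else 0 := by simp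
    _ ≤ ∑ s, E * (Real.exp (r * D s) + Real.exp (-r * D s)) := by
        refine Finset.sum_le_sum fun s _ => ?_
        split_ifs with hs
        · rw [mul_add, hE, ← Real.exp_add, ← Real.exp_add]
          rcases le_abs.mp hs with h | h
          · have h' : 1 ≤ Real.exp (-(r * t) + r * D s) :=
              Real.one_le_exp (by nlinarith [mul_le_mul_of_nonneg_left h hr0])
            linarith [Real.exp_pos (-(r * t) + -r * D s)]
          · have h' : 1 ≤ Real.exp (-(r * t) + -r * D s) :=
              Real.one_le_exp (by nlinarith [mul_le_mul_of_nonneg_left h hr0])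
            linarith [Real.exp_pos (-(r * t) + r * D s)]
        · positivity
    _ = E * (∑ s, Real.exp (r * D s) + ∑ s, Real.exp (-r * D s)) := by
        rw [← Finset.mul_sum, Finset.sum_add_distrib]
    _ ≤ E * (2 * (Fintype.card (Fin L ↪ α)
          * Real.exp (L * (r ^ 2 * (b - a) ^ 2 / 8)))) := by
        refine mul_le_mul_of_nonneg_left ?_ (Real.exp_nonneg _)
        linarith
    _ = Fintype.card (Fin L ↪ α) * (2 * (E * Real.exp (L * (r ^ 2 * (b - a) ^ 2 / 8)))) := by
        ring
    _ = _ := by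
        rw [hE, ← Real.exp_add]
        congr 3
        rw [hr]
        field_simp
        ring

/-- The sample-size condition makes the deviation `(L + 2) ε - B` left after the bias `B`
large enough for Hoeffding's inequality at level `δ`. -/
lemma deviation_bound_of_sample_size {L M R B ε δ : ℝ} (hL : 1 ≤ L) (hM : 2 ≤ M)
    (hR : 0 < R) (hB0 : 0 ≤ B) (hBR : B ≤ R) (hε : 0 < ε) (hδ0 : 0 < δ) (hδ1 : δ < 1)
    (hcond : Real.log (2 * M / δ) * R ^ 2 / (2 * ε ^ 2) ≤ L * ((M - L) / (M - 1))) :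
    0 ≤ (L + 2) * ε - B ∧
      Real.log (2 / δ) ≤ 2 * ((L + 2) * ε - B) ^ 2 / (L * R ^ 2) := by
  have hlog : Real.log (2 * M / δ) = Real.log (2 / δ) + Real.log M := by
    rw [← Real.log_mul (by positivity) (by positivity)]
    congr 1
    ring
  have hlog2 : 1 / 2 ≤ Real.log 2 := by linarith [Real.log_two_gt_d9]
  have hlogM : 1 / 2 ≤ Real.log M := hlog2.trans (Real.log_le_log (by norm_num) hM)
  have hlogδ : 1 / 2 ≤ Real.log (2 / δ) :=
    hlog2.trans (Real.log_le_log (by norm_num) (by rw [le_div_iff₀ hδ0]; linarith))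
  have hq : (M - L) / (M - 1) ≤ 1 := div_le_one_of_le₀ (by linarith) (by linarith)
  have hkey : (Real.log (2 / δ) + Real.log M) * R ^ 2 ≤ L * (2 * ε ^ 2) := by
    rw [← hlog, ← div_le_iff₀ (by positivity)]
    exact hcond.trans (mul_le_of_le_one_right (by linarith) hq)
  have hR2 : 0 < R ^ 2 := by positivity
  have hR2le : R ^ 2 ≤ L * (2 * ε ^ 2) := by nlinarith
  have hδle : Real.log (2 / δ) * R ^ 2 ≤ L * (2 * ε ^ 2) - R ^ 2 / 2 := by nlinarith
  have hBsq : B ^ 2 ≤ R ^ 2 := pow_le_pow_left₀ hB0 hBR 2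
  constructor
  · rw [sub_nonneg]
    refine hBR.trans (abs_le_of_sq_le_sq' ?_ (by positivity) |>.2)
    nlinarith [sq_nonneg (L * ε), sq_nonneg ε, mul_pos (by linarith : 0 < L) (pow_pos hε 2)]
  · rw [le_div_iff₀ (by positivity)]
    have h₁ : L * (Real.log (2 / δ) * R ^ 2) ≤ L * (L * (2 * ε ^ 2) - B ^ 2 / 2) :=
      mul_le_mul_of_nonneg_left (by linarith) (by linarith)
    have h₂ : 0 ≤ 4 * L * (2 * ε - B / 2) ^ 2 := by positivity
    nlinarith [sq_nonneg (2 * ε - B)]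

/-- Splitting two distinct points off a sum over a finite type. -/
lemma sum_eq_add_add_sum_subtype {Ω : Type*} [Fintype Ω] [DecidableEq Ω] (f : Ω → ℝ) {p m : Ω}
    (hpm : p ≠ m) : ∑ ω, f ω = f p + f m + ∑ ω : {ω : Ω // ω ≠ p ∧ ω ≠ m}, f ω := by
  rw [← Finset.sum_subtype ((Finset.univ.erase m).erase p) (by simp) f,
    Finset.sum_erase_eq_sub (by simp [hpm]), Finset.sum_erase_eq_sub (Finset.mem_univ m)]
  ring

/-- If a deviation of the augmented estimator exceeds `ε`, then the sample sum deviates from its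
mean by at least `(L + 2) ε` minus the bias caused by the two fixed points. -/
lemma le_abs_sub_of_lt_abs_augmented {p m S ν L M ε : ℝ} (hL : 0 ≤ L) (hLM : L ≤ M)
    (hν : m ≤ ν ∧ ν ≤ p)
    (h : ε < |(m + p + S) / (L + 2) - (p + m + M * ν) / (M + 2)|) :
    (L + 2) * ε - (p - m) * ((M - L) / (M + 2)) ≤ |S - L * ν| := by
  have hL2 : 0 < L + 2 := by linarith
  have hM2 : 0 < M + 2 := by linarith
  set q := (M - L) / (M + 2) with hq
  have hq0 : 0 ≤ q := div_nonneg (by linarith) hM2.le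
  have hid : (m + p + S) / (L + 2) - (p + m + M * ν) / (M + 2)
      = ((S - L * ν) + (p + m - 2 * ν) * q) / (L + 2) := by
    rw [hq]
    field_simp
    ring
  rw [hid, abs_div, abs_of_pos hL2, lt_div_iff₀ hL2] at h
  have hb : |(p + m - 2 * ν) * q| ≤ (p - m) * q := by
    rw [abs_mul, abs_of_nonneg hq0]
    exact mul_le_mul_of_nonneg_right (abs_le.mpr ⟨by linarith, by linarith⟩) hq0
  have := abs_add_le (S - L * ν) ((p + m - 2 * ν) * q)
  linarith

theorem stmt4 {Ω : Type*} [Fintype Ω] (hΩ : 4 ≤ Fintype.card Ω)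
    (A : Ω → ℝ) (hA0 : ∀ ω, 0 ≤ A ω) (hA1 : ∀ ω, A ω ≤ 1)
    (ωp ωm : Ω) (hpm : ωp ≠ ωm)
    (hplus : A ωp - populationMean A ≥ populationStd A)
    (hminus : populationMean A - A ωm ≥ populationStd A)
    (hextreme : ∀ ω, A ωm ≤ A ω ∧ A ω ≤ A ωp)
    (L : ℕ) (hL1 : 1 ≤ L) (hL2 : L + 2 ≤ Fintype.card Ω)
    (ε δ : ℝ) (hε : 0 < ε) (hδ0 : 0 < δ) (hδ1 : δ < 1)
    (hcond : (L : ℝ) * (((Fintype.card Ω : ℝ) - 2 - L) / ((Fintype.card Ω : ℝ) - 3))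
        ≥ Real.log (2 * ((Fintype.card Ω : ℝ) - 2) / δ) * (A ωp - A ωm) ^ 2 / (2 * ε ^ 2)) :
    uniformProb (fun s : Fin L ↪ {ω : Ω // ω ≠ ωp ∧ ω ≠ ωm} =>
        |augmentedEstimator A ωp ωm s - populationMean A| ≤ ε) ≥ 1 - δ := by
  classical
  set α := {ω : Ω // ω ≠ ωp ∧ ω ≠ ωm} with hα
  set x : α → ℝ := fun i => A i with hxdef
  set N : ℝ := (Fintype.card Ω : ℝ) with hN
  set M : ℝ := (Fintype.card α : ℝ) with hM
  have hNM : N = M + 2 := by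
    have h := sum_eq_add_add_sum_subtype (fun _ : Ω => (1 : ℝ)) hpm
    simp only [Finset.sum_const, Finset.card_univ, nsmul_eq_mul, mul_one] at h
    rw [hN, h]
    ring
  have hLα : L ≤ Fintype.card α := by
    have h : (L : ℝ) + 2 ≤ N := by rw [hN]; exact_mod_cast hL2
    have h' : (L : ℝ) ≤ M := by linarith
    rw [hM] at h'
    exact_mod_cast h'
  have hM2 : 2 ≤ M := by
    have : (4 : ℝ) ≤ N := by rw [hN]; exact_mod_cast hΩ
    linarith
  have hL1r : (1 : ℝ) ≤ L := by exact_mod_cast hL1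
  have hLMr : (L : ℝ) ≤ M := by rw [hM]; exact_mod_cast hLα
  have hsumx : ∑ i, x i = M * populationMean x := by
    rw [populationMean, ← hM]
    field_simp
  have hmean : populationMean A = (A ωp + A ωm + M * populationMean x) / (M + 2) := by
    rw [populationMean, sum_eq_add_add_sum_subtype A hpm, ← hN, hNM, ← hsumx]
    ring
  have hx : ∀ i, x i ∈ Set.Icc (A ωm) (A ωp) := fun i => hextreme i
  have hν : A ωm ≤ populationMean x ∧ populationMean x ≤ A ωp := by
    have hMpos : 0 < M := by linarith
    have h₁ := Finset.card_nsmul_le_sum Finset.univ x (A ωm) fun i _ => (hx i).1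
    have h₂ := Finset.sum_le_card_nsmul Finset.univ x (A ωp) fun i _ => (hx i).2
    rw [hsumx, nsmul_eq_mul, Finset.card_univ, ← hM] at h₁ h₂
    exact ⟨le_of_mul_le_mul_left h₁ hMpos, le_of_mul_le_mul_left h₂ hMpos⟩
  have hne : Nonempty (Fin L ↪ α) :=
    Function.Embedding.nonempty_of_card_le (by rwa [Fintype.card_fin])
  have hK : (0 : ℝ) < Fintype.card (Fin L ↪ α) := by exact_mod_cast Fintype.card_pos
  set G := Finset.univ.filter fun s : Fin L ↪ α =>
    |augmentedEstimator A ωp ωm s - populationMean A| ≤ ε with hG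
  set F := Finset.univ.filter fun s : Fin L ↪ α =>
    ¬ |augmentedEstimator A ωp ωm s - populationMean A| ≤ ε with hF
  have hGF : (G.card : ℝ) + F.card = Fintype.card (Fin L ↪ α) := by
    exact_mod_cast Finset.card_filter_add_card_filter_not (s := Finset.univ)
      fun s : Fin L ↪ α => |augmentedEstimator A ωp ωm s - populationMean A| ≤ ε
  suffices hbad : (F.card : ℝ) ≤ Fintype.card (Fin L ↪ α) * δ by
    rw [uniformProb, Nat.card_eq_fintype_card, Nat.card_eq_fintype_card, Fintype.card_subtype,
      ge_iff_le, le_div_iff₀ hK]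
    linarith
  have hdev : ∀ s ∈ F, (L + 2) * ε - (A ωp - A ωm) * ((M - L) / (M + 2))
      ≤ |∑ l, x (s l) - L * populationMean x| := by
    intro s hs
    have hs' := not_le.mp (Finset.mem_filter.mp hs).2
    rw [augmentedEstimator, hmean] at hs'
    exact le_abs_sub_of_lt_abs_augmented (by linarith) hLMr hν hs'
  rcases (hextreme ωp).1.eq_or_lt with hR | hR
  · have hconst : ∀ i, x i = A ωp := fun i => le_antisymm (hx i).2 (hR ▸ (hx i).1)
    have hνe : populationMean x = A ωp := le_antisymm hν.2 (hR ▸ hν.1)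
    have hempty : F = ∅ := by
      refine Finset.eq_empty_of_forall_notMem fun s hs => ?_
      have h := hdev s hs
      simp only [hconst, hνe, hR, Finset.sum_const, Finset.card_univ, Fintype.card_fin,
        nsmul_eq_mul, sub_self, zero_mul, abs_zero, sub_zero] at h
      nlinarith
    rw [hempty]
    simp only [Finset.card_empty, Nat.cast_zero]
    positivity
  · have hRpos : 0 < A ωp - A ωm := sub_pos.mpr hR
    rw [hNM, show M + 2 - 2 - (L : ℝ) = M - L by ring, show M + 2 - 3 = M - 1 by ring,
      show M + 2 - 2 = M by ring] at hcond
    have hq0 : 0 ≤ (M - L) / (M + 2) := div_nonneg (by linarith) (by linarith)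
    have hq1 : (M - L) / (M + 2) ≤ 1 := div_le_one_of_le₀ (by linarith) (by linarith)
    obtain ⟨ht, hlog⟩ := deviation_bound_of_sample_size hL1r hM2 hRpos
      (mul_nonneg hRpos.le hq0) (mul_le_of_le_one_right hRpos.le hq1) hε hδ0 hδ1 hcond
    have hFle := Finset.card_le_card (fun s hs => Finset.mem_filter.mpr
      ⟨Finset.mem_univ s, hdev s hs⟩ : F ⊆ Finset.univ.filter fun s : Fin L ↪ α =>
        (L + 2) * ε - (A ωp - A ωm) * ((M - L) / (M + 2))
          ≤ |∑ l, x (s l) - L * populationMean x|)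
    refine (Nat.cast_le.mpr hFle).trans
      ((card_embedding_abs_ge_le hL1 hLα x hR hx ht).trans ?_)
    refine mul_le_mul_of_nonneg_left ?_ hK.le
    have h := Real.exp_le_exp.mpr (neg_le_neg hlog)
    rw [Real.exp_neg (Real.log _), Real.exp_log (by positivity), inv_div] at h
    linarith
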